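/- arXiv:1802.07994 — 2 statements merged into one kernel-verified Lean document; each statement's English description precedes it below -/
import Mathlib

section
/- (Rotational symmetry for circular boundary; graph form of Corollary 6.) Let x₀ ∈ ℝ², r > 0, let B = B(x₀, r) be the open disk of radius r centered at x₀, let λ ∈ ℝ, and let u be continuous on the closed disk, equal to 0 at every point of the boundary circle |x − x₀| = r, and satisfy the λ-soliton graph equation on B. Then u is rotationally symmetric about x₀: for all x, y in the closed disk with |x − x₀| = |y − x₀| one has u(x) = u(y). In particular, the graph of u is a surface of revolution whose rotation axis is the vertical line through x₀. -/
open MeasureTheory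

noncomputable section

/-- The Euclidean plane. -/
abbrev E2 := EuclideanSpace ℝ (Fin 2)

/-- `W u x = √(1 + ‖∇u(x)‖²)`. -/
noncomputable def W (u : E2 → ℝ) (x : E2) : ℝ := Real.sqrt (1 + ‖gradient u x‖ ^ 2)

/-- The divergence of a vector field `X : ℝ² → ℝ²`: `div X = ∂₁X₁ + ∂₂X₂`. -/
noncomputable def div2 (X : E2 → E2) (x : E2) : ℝ :=
  ∑ i : Fin 2, fderiv ℝ X x (EuclideanSpace.single i 1) i

/-- `u` satisfies the λ-soliton graph equation on the open set `D`: `u` is C² on `D` and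
`div (∇u / W(u)) = 2λ + 1/W(u)` at every point of `D`. -/
def SatisfiesSolitonEq (lam : ℝ) (D : Set E2) (u : E2 → ℝ) : Prop :=
  ContDiffOn ℝ 2 u D ∧
    ∀ x ∈ D, div2 (fun y => (W u y)⁻¹ • gradient u y) x = 2 * lam + (W u x)⁻¹

end

open scoped Topology

noncomputable section

/-- The trace of a bilinear form on the Euclidean plane. -/
def bilinTrace (M : E2 →L[ℝ] E2 →L[ℝ] ℝ) : ℝ :=
  ∑ i : Fin 2, M (EuclideanSpace.single i 1) (EuclideanSpace.single i 1)

/-- The non-divergence form `(1 + |p|²) tr M - M(p, p) - 2λ (1 + |p|²)^{3/2} - (1 + |p|²)` of the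
soliton operator, as a function of the gradient `p` and the Hessian `M`. -/
def solitonOp (lam : ℝ) (p : E2) (M : E2 →L[ℝ] E2 →L[ℝ] ℝ) : ℝ :=
  (1 + ‖p‖ ^ 2) * bilinTrace M - M p p - 2 * lam * Real.sqrt (1 + ‖p‖ ^ 2) ^ 3 - (1 + ‖p‖ ^ 2)

lemma bilinTrace_eq_sum (M : E2 →L[ℝ] E2 →L[ℝ] ℝ) (b : OrthonormalBasis (Fin 2) ℝ E2) :
    bilinTrace M = ∑ i, M (b i) (b i) := by
  let L : E2 →ₗ[ℝ] E2 →ₗ[ℝ] ℝ :=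
    LinearMap.mk₂ ℝ (fun x y => M x y) (by simp) (by simp) (by simp) (by simp)
  have h := (InnerProductSpace.canonicalCovariantTensor_eq_sum E2
    (EuclideanSpace.basisFun (Fin 2) ℝ)).symm.trans
      (InnerProductSpace.canonicalCovariantTensor_eq_sum E2 b)
  simpa [bilinTrace, L] using congrArg (TensorProduct.lift L) h

lemma bilinTrace_comp_isometry (M : E2 →L[ℝ] E2 →L[ℝ] ℝ) (R : E2 ≃ₗᵢ[ℝ] E2) :
    ∑ i : Fin 2, M (R (EuclideanSpace.single i 1)) (R (EuclideanSpace.single i 1)) =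
      bilinTrace M := by
  simp [bilinTrace_eq_sum M ((EuclideanSpace.basisFun (Fin 2) ℝ).map R)]

lemma eq_sum_single (p : E2) :
    p = p 0 • EuclideanSpace.single 0 1 + p 1 • EuclideanSpace.single 1 1 := by
  ext i; fin_cases i <;> simp

lemma norm_sq_eq (p : E2) : ‖p‖ ^ 2 = p 0 ^ 2 + p 1 ^ 2 := by
  simp [EuclideanSpace.norm_sq_eq]

/-- In the plane, `(1 + |p|²) tr M - M(p, p) = tr M + M(Jp, Jp)` with `J` the quarter turn. -/
lemma principal_part_eq (p : E2) (M : E2 →L[ℝ] E2 →L[ℝ] ℝ) :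
    (1 + ‖p‖ ^ 2) * bilinTrace M - M p p =
      bilinTrace M + M !₂[-p 1, p 0] !₂[-p 1, p 0] := by
  rw [norm_sq_eq]
  conv_lhs => rw [show M p p = M (p 0 • EuclideanSpace.single 0 1 + p 1 • EuclideanSpace.single 1 1)
    (p 0 • EuclideanSpace.single 0 1 + p 1 • EuclideanSpace.single 1 1) by rw [← eq_sum_single]]
  rw [eq_sum_single !₂[-p 1, p 0]]
  simp [bilinTrace]
  ring

lemma gradient_apply (u : E2 → ℝ) (x : E2) (i : Fin 2) :
    gradient u x i = fderiv ℝ u x (EuclideanSpace.single i 1) := by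
  rw [← inner_gradient_left, EuclideanSpace.inner_single_right]
  simp

lemma hasFDerivAt_gradient {u : E2 → ℝ} {x : E2} (hu : ContDiffAt ℝ 2 u x) :
    HasFDerivAt (fderiv ℝ u) (fderiv ℝ (fderiv ℝ u) x) x :=
  ((hu.fderiv_right (m := 1) (by norm_num)).differentiableAt (by norm_num)).hasFDerivAt

lemma hasFDerivAt_gradient_apply {u : E2 → ℝ} {x : E2} (hu : ContDiffAt ℝ 2 u x) (i : Fin 2) :
    HasFDerivAt (fun y => gradient u y i)
      ((fderiv ℝ (fderiv ℝ u) x).flip (EuclideanSpace.single i 1)) x := by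
  simp_rw [gradient_apply]
  exact ((hasFDerivAt_gradient hu).clm_apply
    (hasFDerivAt_const (EuclideanSpace.single i 1) x)).congr_fderiv (by simp)

lemma hasFDerivAt_W {u : E2 → ℝ} {x : E2} (hu : ContDiffAt ℝ 2 u x) :
    HasFDerivAt (W u)
      ((W u x)⁻¹ • (fderiv ℝ (fderiv ℝ u) x).flip (gradient u x)) x := by
  have h : HasFDerivAt (fun y => 1 + (gradient u y 0 ^ 2 + gradient u y 1 ^ 2)) _ x :=
    (((hasFDerivAt_gradient_apply hu 0).pow 2).add
      ((hasFDerivAt_gradient_apply hu 1).pow 2)).const_add 1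
  have h2 := h.sqrt (by positivity)
  unfold W
  simp_rw [norm_sq_eq]
  refine h2.congr_fderiv (ContinuousLinearMap.ext fun v => ?_)
  have hw : √(1 + (gradient u x 0 ^ 2 + gradient u x 1 ^ 2)) ≠ 0 :=
    (Real.sqrt_pos.2 (by positivity)).ne'
  conv_rhs => rw [eq_sum_single (gradient u x)]
  simp
  field_simp

lemma W_pos (u : E2 → ℝ) (x : E2) : 0 < W u x := Real.sqrt_pos.2 (by positivity)

lemma div2_eq {u : E2 → ℝ} {x : E2} (hu : ContDiffAt ℝ 2 u x) :
    div2 (fun y => (W u y)⁻¹ • gradient u y) x =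
      (W u x)⁻¹ * bilinTrace (fderiv ℝ (fderiv ℝ u) x)
        - ((W u x)⁻¹) ^ 3 * fderiv ℝ (fderiv ℝ u) x (gradient u x) (gradient u x) := by
  have hW := (W_pos u x).ne'
  have hc : ∀ i : Fin 2, HasFDerivAt (fun y => (W u y)⁻¹ * gradient u y i) _ x := fun i =>
    (((hasDerivAt_inv hW).comp_hasFDerivAt x (hasFDerivAt_W hu))).mul
      (hasFDerivAt_gradient_apply hu i)
  have hX : DifferentiableAt ℝ (fun y => (W u y)⁻¹ • gradient u y) x := by
    rw [differentiableAt_euclidean]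
    exact fun i => (hc i).differentiableAt
  have key : ∀ i : Fin 2, ∀ v : E2, fderiv ℝ (fun y => (W u y)⁻¹ • gradient u y) x v i =
      fderiv ℝ (fun y => (W u y)⁻¹ * gradient u y i) x v := by
    intro i v
    have := ((EuclideanSpace.proj i : E2 →L[ℝ] ℝ).hasFDerivAt.comp x
      hX.hasFDerivAt).fderiv
    exact (DFunLike.congr_fun this v).symm
  unfold div2
  simp_rw [key, (hc _).fderiv]
  conv_rhs => rw [eq_sum_single (gradient u x)]
  simp [bilinTrace]
  conv_lhs => rw [eq_sum_single (gradient u x)]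
  simp
  field_simp
  ring

lemma solitonEq_iff {lam : ℝ} {u : E2 → ℝ} {x : E2} (hu : ContDiffAt ℝ 2 u x) :
    div2 (fun y => (W u y)⁻¹ • gradient u y) x = 2 * lam + (W u x)⁻¹ ↔
      solitonOp lam (gradient u x) (fderiv ℝ (fderiv ℝ u) x) = 0 := by
  rw [div2_eq hu]
  have hW := W_pos u x
  have h2 : 1 + ‖gradient u x‖ ^ 2 = W u x ^ 2 := (Real.sq_sqrt (by positivity)).symm
  have h3 : Real.sqrt (1 + ‖gradient u x‖ ^ 2) = W u x := rfl
  rw [solitonOp, h3, h2, ← sub_eq_zero]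
  rw [← mul_eq_zero_iff_left (pow_pos hW 3).ne']
  refine Eq.congr_left ?_
  field_simp
  ring

/-- Second-order necessary condition for a local maximum. -/
lemma IsLocalMax.fderiv_fderiv_nonpos {E : Type*} [NormedAddCommGroup E] [NormedSpace ℝ E]
    {g : E → ℝ} {z : E} (hg : ContDiffAt ℝ 2 g z) (hz : IsLocalMax g z) (h : E) :
    fderiv ℝ (fderiv ℝ g) z h h ≤ 0 := by
  by_contra! hpos
  set l : ℝ → E := fun t => z + t • h with hl
  have hl0 : l 0 = z := by simp [hl]
  have hld : ∀ t, HasDerivAt l h t := fun t => by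
    simpa [hl] using ((hasDerivAt_id t).smul_const h).const_add z
  have hlc : ContinuousAt l 0 := (hld 0).continuousAt
  have hgd : ∀ᶠ t in 𝓝 (0 : ℝ), deriv (g ∘ l) t = fderiv ℝ g (l t) h := by
    have : ∀ᶠ y in 𝓝 (l 0), ContDiffAt ℝ 2 g y := hl0 ▸ hg.eventually (by simp)
    filter_upwards [hlc.eventually this] with t ht
    exact ((ht.differentiableAt (by norm_num)).hasFDerivAt.comp_hasDerivAt t (hld t)).deriv
  have hdd : deriv (deriv (g ∘ l)) 0 = fderiv ℝ (fderiv ℝ g) z h h := by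
    rw [Filter.EventuallyEq.deriv_eq hgd]
    have h1 : HasFDerivAt (fderiv ℝ g) (fderiv ℝ (fderiv ℝ g) z) (l 0) := by
      rw [hl0]
      exact ((hg.fderiv_right (m := 1) (by norm_num)).differentiableAt (by norm_num)).hasFDerivAt
    simpa using ((h1.comp_hasDerivAt 0 (hld 0)).clm_apply (hasDerivAt_const 0 h)).deriv
  have hmax : IsLocalMax (g ∘ l) 0 := by
    have : IsLocalMax g (l 0) := hl0 ▸ hz
    exact hlc.eventually this
  have hcont : ContinuousAt (g ∘ l) 0 :=
    ContinuousAt.comp (by rw [hl0]; exact hg.continuousAt) hlc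
  have hmin := isLocalMin_of_deriv_deriv_pos (hdd ▸ hpos) hmax.deriv_eq_zero hcont
  have hconst : g ∘ l =ᶠ[𝓝 0] fun _ => (g ∘ l) 0 := by
    filter_upwards [hmax, hmin] with t h1 h2 using le_antisymm h1 h2
  have := hconst.deriv.deriv_eq
  simp [hdd] at this
  exact hpos.ne' this

lemma hasFDerivAt_comp_isometry {u : E2 → ℝ} (R : E2 ≃ₗᵢ[ℝ] E2) (c : E2) {z : E2}
    (hu : DifferentiableAt ℝ u (R z + c)) :
    HasFDerivAt (fun y => u (R y + c))
      ((fderiv ℝ u (R z + c)).comp (R : E2 →L[ℝ] E2)) z :=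
  hu.hasFDerivAt.comp z ((R : E2 →L[ℝ] E2).hasFDerivAt.add_const c)

lemma gradient_comp_isometry {u : E2 → ℝ} (R : E2 ≃ₗᵢ[ℝ] E2) (c : E2) {z : E2}
    (hu : DifferentiableAt ℝ u (R z + c)) :
    R (gradient (fun y => u (R y + c)) z) = gradient u (R z + c) := by
  refine ext_inner_right ℝ fun h => ?_
  rw [← R.apply_symm_apply h, R.inner_map_map, inner_gradient_left, inner_gradient_left,
    (hasFDerivAt_comp_isometry R c hu).fderiv]
  simp

lemma hessian_comp_isometry {u : E2 → ℝ} (R : E2 ≃ₗᵢ[ℝ] E2) (c : E2) {z : E2}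
    (hu : ContDiffAt ℝ 2 u (R z + c)) (h k : E2) :
    fderiv ℝ (fderiv ℝ fun y => u (R y + c)) z h k =
      fderiv ℝ (fderiv ℝ u) (R z + c) (R h) (R k) := by
  have hT : HasFDerivAt (fun y => R y + c) (R : E2 →L[ℝ] E2) z :=
    (R : E2 →L[ℝ] E2).hasFDerivAt.add_const c
  have hev : fderiv ℝ (fun y => u (R y + c)) =ᶠ[𝓝 z]
      fun y => (fderiv ℝ u (R y + c)).comp (R : E2 →L[ℝ] E2) := by
    filter_upwards [hT.continuousAt.eventually (hu.eventually (by simp))] with y hy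
    exact (hasFDerivAt_comp_isometry R c (hy.differentiableAt (by norm_num))).fderiv
  rw [hev.fderiv_eq]
  have h1 : HasFDerivAt (fun y => fderiv ℝ u (R y + c)) _ z :=
    (hasFDerivAt_gradient hu).comp z hT
  rw [(h1.clm_comp (hasFDerivAt_const (R : E2 →L[ℝ] E2) z)).fderiv]
  simp

/-- The soliton equation is invariant under rigid motions of the plane. -/
lemma SatisfiesSolitonEq.comp_isometry {lam : ℝ} {D D' : Set E2} {u : E2 → ℝ} (hD : IsOpen D)
    (hu : SatisfiesSolitonEq lam D u) (R : E2 ≃ₗᵢ[ℝ] E2) (c : E2)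
    (hmap : ∀ z ∈ D', R z + c ∈ D) :
    SatisfiesSolitonEq lam D' fun y => u (R y + c) := by
  have hc : ∀ z ∈ D', ContDiffAt ℝ 2 u (R z + c) := fun z hz =>
    hu.1.contDiffAt (hD.mem_nhds (hmap z hz))
  have hv : ∀ z ∈ D', ContDiffAt ℝ 2 (fun y => u (R y + c)) z := fun z hz =>
    (hc z hz).comp z ((R.contDiff.add contDiff_const).contDiffAt)
  refine ⟨fun z hz => (hv z hz).contDiffWithinAt, fun z hz => ?_⟩
  have hsol := (solitonEq_iff (hc z hz)).1 (hu.2 _ (hmap z hz))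
  rw [solitonEq_iff (hv z hz)]
  have hg := gradient_comp_isometry R c ((hc z hz).differentiableAt (by norm_num))
  have hn : ‖gradient (fun y => u (R y + c)) z‖ = ‖gradient u (R z + c)‖ := by
    rw [← hg, R.norm_map]
  rw [← hsol, solitonOp, solitonOp, hn, hessian_comp_isometry R c (hc z hz), hg]
  congr 4
  rw [bilinTrace]
  simp_rw [hessian_comp_isometry R c (hc z hz)]
  exact bilinTrace_comp_isometry _ R

lemma contDiff_bilinTrace : ContDiff ℝ 1 bilinTrace := by
  unfold bilinTrace
  fun_prop

lemma contDiff_solitonOp (lam : ℝ) :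
    ContDiff ℝ 1 fun q : E2 × (E2 →L[ℝ] E2 →L[ℝ] ℝ) => solitonOp lam q.1 q.2 := by
  have hn : ContDiff ℝ 1 fun q : E2 × (E2 →L[ℝ] E2 →L[ℝ] ℝ) => 1 + ‖q.1‖ ^ 2 :=
    contDiff_const.add (contDiff_fst.norm_sq ℝ)
  have hs : ContDiff ℝ 1 fun q : E2 × (E2 →L[ℝ] E2 →L[ℝ] ℝ) => Real.sqrt (1 + ‖q.1‖ ^ 2) :=
    hn.sqrt fun q => by positivity
  have hb : ContDiff ℝ 1 fun q : E2 × (E2 →L[ℝ] E2 →L[ℝ] ℝ) => q.2 q.1 q.1 := by fun_prop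
  exact (((hn.mul (contDiff_bilinTrace.comp contDiff_snd)).sub hb).sub
    (contDiff_const.mul (hs.pow 3))).sub hn

/-- On bounded sets the soliton operator is Lipschitz in the gradient variable. -/
lemma exists_lipschitz_solitonOp (lam S : ℝ) :
    ∃ C : ℝ, 0 ≤ C ∧ ∀ (p q : E2) (M : E2 →L[ℝ] E2 →L[ℝ] ℝ), ‖p‖ ≤ S → ‖q‖ ≤ S → ‖M‖ ≤ S →
      solitonOp lam p M - solitonOp lam q M ≤ C * ‖p - q‖ := by
  have : ProperSpace (E2 →L[ℝ] E2 →L[ℝ] ℝ) := FiniteDimensional.proper ℝ (E2 →L[ℝ] E2 →L[ℝ] ℝ)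
  obtain ⟨K, hK⟩ :=
    (contDiff_solitonOp lam).locallyLipschitz.locallyLipschitzOn.exists_lipschitzOnWith_of_compact
      (isCompact_closedBall (0 : E2 × (E2 →L[ℝ] E2 →L[ℝ] ℝ)) S)
  refine ⟨K, K.2, fun p q M hp hq hM => ?_⟩
  have hM' : dist M 0 ≤ S := (dist_zero_right M).trans_le hM
  have h := hK.dist_le_mul (p, M) (by simpa [Prod.dist_eq, hp] using hM')
    (q, M) (by simpa [Prod.dist_eq, hq] using hM')
  rw [dist_prod_same_right, Real.dist_eq, dist_eq_norm] at h
  exact (le_abs_self _).trans h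

lemma solitonOp_sub (lam : ℝ) (p : E2) (M N : E2 →L[ℝ] E2 →L[ℝ] ℝ) :
    solitonOp lam p M - solitonOp lam p N =
      bilinTrace (M - N) + (M - N) !₂[-p 1, p 0] !₂[-p 1, p 0] := by
  rw [← principal_part_eq]
  simp [solitonOp, bilinTrace]
  ring

/-- The exponential barrier `z ↦ exp (γ z₀)`. -/
def expBarrier (γ : ℝ) (z : E2) : ℝ := Real.exp (γ * z 0)

lemma contDiff_expBarrier (γ : ℝ) : ContDiff ℝ 2 (expBarrier γ) := by
  unfold expBarrier
  fun_prop

lemma fderiv_expBarrier (γ : ℝ) :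
    fderiv ℝ (expBarrier γ) =
      fun z => (γ * expBarrier γ z) • (EuclideanSpace.proj 0 : E2 →L[ℝ] ℝ) := by
  ext1 z
  have h : HasFDerivAt (fun y : E2 => γ * y 0) (γ • (EuclideanSpace.proj 0 : E2 →L[ℝ] ℝ)) z :=
    ((EuclideanSpace.proj 0 : E2 →L[ℝ] ℝ).hasFDerivAt).const_mul γ
  rw [HasFDerivAt.fderiv (f := expBarrier γ) h.exp, smul_smul, mul_comm γ (expBarrier γ z)]
  rfl

lemma hessian_expBarrier (γ : ℝ) (z h k : E2) :
    fderiv ℝ (fderiv ℝ (expBarrier γ)) z h k = γ ^ 2 * expBarrier γ z * (h 0 * k 0) := by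
  have hd : HasFDerivAt (expBarrier γ) _ z :=
    ((contDiff_expBarrier γ).differentiable (by norm_num) z).hasFDerivAt
  rw [fderiv_expBarrier] at hd ⊢
  rw [((hd.const_mul γ).smul_const (EuclideanSpace.proj 0 : E2 →L[ℝ] ℝ)).fderiv]
  simp
  ring

/-- The quantitative inequality behind the comparison principle: at an interior local maximum of
`u - v + ε exp (γ z₀)` between two solutions, `γ` is bounded by the Lipschitz constant of the
operator. -/
lemma not_isLocalMax_sub_add_expBarrier {lam : ℝ} {u v : E2 → ℝ} {z : E2}
    (hu : ContDiffAt ℝ 2 u z) (hv : ContDiffAt ℝ 2 v z)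
    (hsu : solitonOp lam (gradient u z) (fderiv ℝ (fderiv ℝ u) z) = 0)
    (hsv : solitonOp lam (gradient v z) (fderiv ℝ (fderiv ℝ v) z) = 0)
    {C γ ε : ℝ} (hC : 0 ≤ C) (hγ : C < γ) (hε : 0 < ε)
    (hlip : solitonOp lam (gradient u z) (fderiv ℝ (fderiv ℝ v) z) -
      solitonOp lam (gradient v z) (fderiv ℝ (fderiv ℝ v) z) ≤
        C * ‖gradient u z - gradient v z‖) :
    ¬ IsLocalMax (fun y => u y - v y + ε * expBarrier γ y) z := by
  intro hmax
  have hE : ∀ y, ContDiffAt ℝ 2 (expBarrier γ) y := fun y => (contDiff_expBarrier γ).contDiffAt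
  have hEpos : 0 < expBarrier γ z := Real.exp_pos _
  have hγ0 : 0 < γ := hC.trans_lt hγ
  have hg : ContDiffAt ℝ 2 (fun y => u y - v y + ε * expBarrier γ y) z :=
    (hu.sub hv).add (contDiffAt_const.mul (hE z))
  have hfd : ∀ y, ContDiffAt ℝ 2 u y → ContDiffAt ℝ 2 v y →
      fderiv ℝ (fun y => u y - v y + ε * expBarrier γ y) y =
        fderiv ℝ u y - fderiv ℝ v y + ε • fderiv ℝ (expBarrier γ) y := fun y h1 h2 =>
    (((h1.differentiableAt (by norm_num)).hasFDerivAt.sub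
      (h2.differentiableAt (by norm_num)).hasFDerivAt).add
      (((hE y).differentiableAt (by norm_num)).hasFDerivAt.const_mul ε)).fderiv
  have hgrad : gradient u z - gradient v z = -(ε * γ * expBarrier γ z) •
      EuclideanSpace.single 0 1 := by
    refine ext_inner_right ℝ fun h => ?_
    have h0 := DFunLike.congr_fun (hfd z hu hv ▸ hmax.fderiv_eq_zero) h
    simp [fderiv_expBarrier] at h0
    rw [inner_sub_left, inner_gradient_left, inner_gradient_left, inner_smul_left,
      EuclideanSpace.inner_single_left]
    simp
    linarith
  have hnorm : ‖gradient u z - gradient v z‖ = ε * γ * expBarrier γ z := by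
    rw [hgrad, norm_smul, norm_neg, Real.norm_of_nonneg (by positivity)]
    simp
  have hhess : ∀ h, fderiv ℝ (fderiv ℝ u) z h h - fderiv ℝ (fderiv ℝ v) z h h +
      ε * (γ ^ 2 * expBarrier γ z * (h 0 * h 0)) ≤ 0 := by
    intro h
    have hle := hmax.fderiv_fderiv_nonpos hg h
    have hev : fderiv ℝ (fun y => u y - v y + ε * expBarrier γ y) =ᶠ[𝓝 z]
        fun y => fderiv ℝ u y - fderiv ℝ v y + ε • fderiv ℝ (expBarrier γ) y := by
      filter_upwards [hu.eventually (by simp), hv.eventually (by simp)] with y h1 h2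
        using hfd y h1 h2
    have hfd2 : HasFDerivAt
        (fun y => fderiv ℝ u y - fderiv ℝ v y + ε • fderiv ℝ (expBarrier γ) y) _ z :=
      ((hasFDerivAt_gradient hu).sub (hasFDerivAt_gradient hv)).add
        ((hasFDerivAt_gradient (hE z)).const_smul ε)
    rw [hev.fderiv_eq, hfd2.fderiv] at hle
    simpa [hessian_expBarrier] using hle
  have hop := solitonOp_sub lam (gradient u z) (fderiv ℝ (fderiv ℝ u) z) (fderiv ℝ (fderiv ℝ v) z)
  have e0 := hhess (EuclideanSpace.single 0 1)
  have e1 := hhess (EuclideanSpace.single 1 1)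
  have e2 := hhess !₂[-gradient u z 1, gradient u z 0]
  simp only [bilinTrace, Fin.sum_univ_two, sub_apply] at hop
  simp at e0 e1
  rw [hnorm] at hlip
  have e3 : 0 ≤ ε * (γ ^ 2 * expBarrier γ z * (!₂[-gradient u z 1, gradient u z 0] 0 *
    !₂[-gradient u z 1, gradient u z 0] 0)) := by
    exact mul_nonneg hε.le (mul_nonneg (by positivity) (mul_self_nonneg _))
  have e4 : 0 < (γ - C) * (ε * γ * expBarrier γ z) := by
    have : 0 < γ - C := by linarith
    positivity
  nlinarith

/-- Comparison principle for the soliton equation on a bounded open set. -/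
lemma SatisfiesSolitonEq.le_of_le_frontier {lam : ℝ} {D : Set E2} {u v : E2 → ℝ}
    (hD : IsOpen D) (hbdd : Bornology.IsBounded D)
    (hu : SatisfiesSolitonEq lam D u) (hv : SatisfiesSolitonEq lam D v)
    (huc : ContinuousOn u (closure D)) (hvc : ContinuousOn v (closure D))
    (hle : ∀ x ∈ frontier D, u x ≤ v x) : ∀ x ∈ closure D, u x ≤ v x := by
  by_contra! hx
  obtain ⟨x, hxD, hx⟩ := hx
  have hcomp : IsCompact (closure D) := hbdd.isCompact_closure
  have hw : ContinuousOn (fun y => u y - v y) (closure D) := huc.sub hvc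
  set m : ℝ := u x - v x with hm
  have hmpos : 0 < m := sub_pos.2 hx
  set K : Set E2 := closure D ∩ (fun y => u y - v y) ⁻¹' Set.Ici (m / 2) with hK
  have hKc : IsCompact K :=
    hcomp.of_isClosed_subset (hw.preimage_isClosed_of_isClosed isClosed_closure isClosed_Ici)
      Set.inter_subset_left
  have hKD : K ⊆ D := by
    rintro y ⟨hyD, hy⟩
    by_contra hyn
    have := hle y ⟨hyD, by rwa [hD.interior_eq]⟩
    have hy : m / 2 ≤ u y - v y := hy
    linarith
  have hcu : ∀ y ∈ D, ContDiffAt ℝ 2 u y := fun y hy => hu.1.contDiffAt (hD.mem_nhds hy)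
  have hcv : ∀ y ∈ D, ContDiffAt ℝ 2 v y := fun y hy => hv.1.contDiffAt (hD.mem_nhds hy)
  have hgradc : ∀ {f : E2 → ℝ}, (∀ y ∈ D, ContDiffAt ℝ 2 f y) →
      ContinuousOn (gradient f) K := fun {f} hf y hy =>
    ((InnerProductSpace.toDual ℝ E2).symm.continuous.continuousAt.comp
      (hasFDerivAt_gradient (hf y (hKD hy))).continuousAt).continuousWithinAt
  obtain ⟨S₁, hS₁⟩ := hKc.exists_bound_of_continuousOn (hgradc hcu)
  obtain ⟨S₂, hS₂⟩ := hKc.exists_bound_of_continuousOn (hgradc hcv)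
  have hhess : ContinuousOn (fderiv ℝ (fderiv ℝ v)) K := fun y hy =>
    (((((hcv y (hKD hy)).fderiv_right (m := 1) (by norm_num)).fderiv_right (m := 0)
      (by norm_num))).continuousAt).continuousWithinAt
  obtain ⟨S₃, hS₃⟩ := hKc.exists_bound_of_continuousOn (E := E2 →L[ℝ] E2 →L[ℝ] ℝ) hhess
  obtain ⟨C, hC, hlip⟩ := exists_lipschitz_solitonOp lam (max S₁ (max S₂ S₃))
  have hEc : Continuous (expBarrier (C + 1)) := (contDiff_expBarrier _).continuous
  obtain ⟨A, hA⟩ := hcomp.exists_bound_of_continuousOn hEc.continuousOn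
  have hEpos : ∀ y, 0 < expBarrier (C + 1) y := fun y => Real.exp_pos _
  have hApos : 0 < A := (norm_pos_iff.2 (hEpos x).ne').trans_le (hA x hxD)
  set ε : ℝ := m / (2 * A) with hε
  have hεpos : 0 < ε := by positivity
  obtain ⟨z, hzD, hz⟩ := hcomp.exists_isMaxOn ⟨x, hxD⟩
    (hw.add (continuousOn_const.mul (hEc.continuousOn (s := closure D))) :
      ContinuousOn (fun y => u y - v y + ε * expBarrier (C + 1) y) _)
  have hzK : z ∈ K := by
    refine ⟨hzD, ?_⟩
    have h1 : m + ε * expBarrier (C + 1) x ≤ u z - v z + ε * expBarrier (C + 1) z := hz hxD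
    have h2 : ε * expBarrier (C + 1) z ≤ m / 2 :=
      (mul_le_mul_of_nonneg_left ((le_abs_self _).trans (hA z hzD)) hεpos.le).trans_eq
        (by rw [hε]; field_simp)
    have h3 := mul_pos hεpos (hEpos x)
    change m / 2 ≤ u z - v z
    linarith
  have hzD' := hKD hzK
  refine not_isLocalMax_sub_add_expBarrier (hcu z hzD') (hcv z hzD')
    ((solitonEq_iff (hcu z hzD')).1 (hu.2 z hzD')) ((solitonEq_iff (hcv z hzD')).1 (hv.2 z hzD'))
    hC (lt_add_one C) hεpos (hlip _ _ _ ?_ ?_ ?_)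
    (hz.isLocalMax (Filter.mem_of_superset (hD.mem_nhds hzD') subset_closure))
  · exact (hS₁ z hzK).trans (le_max_left _ _)
  · exact (hS₂ z hzK).trans ((le_max_left _ _).trans (le_max_right _ _))
  · exact (hS₃ z hzK).trans ((le_max_right _ _).trans (le_max_right _ _))

end


/-- Rotational symmetry for circular boundary; graph form of Corollary 6: a λ-translating
graph over a disk vanishing on the boundary circle is rotationally symmetric about the
center, i.e. the graph is a surface of revolution with vertical axis through the center. -/
theorem rotational_symmetry_circular_boundary
    (x₀ : E2) (r : ℝ) (hr : 0 < r)
    (lam : ℝ) (u : E2 → ℝ)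
    (hcont : ContinuousOn u (Metric.closedBall x₀ r))
    (hzero : ∀ x ∈ Metric.sphere x₀ r, u x = 0)
    (hsol : SatisfiesSolitonEq lam (Metric.ball x₀ r) u) :
    ∀ x ∈ Metric.closedBall x₀ r, ∀ y ∈ Metric.closedBall x₀ r,
      dist x x₀ = dist y x₀ → u x = u y := by
  suffices key : ∀ x ∈ Metric.closedBall x₀ r, ∀ y ∈ Metric.closedBall x₀ r,
      dist x x₀ = dist y x₀ → u x ≤ u y from fun x hx y hy h =>
    le_antisymm (key x hx y hy h) (key y hy x hx h.symm)
  intro x hx y _ hxy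
  let R : E2 ≃ₗᵢ[ℝ] E2 := (ℝ ∙ ((x - x₀) - (y - x₀)))ᗮ.reflection
  have hR : R (x - x₀) = y - x₀ :=
    Submodule.reflection_sub (by rwa [← dist_eq_norm, ← dist_eq_norm])
  have hdist : ∀ z, dist (R z + (x₀ - R x₀)) x₀ = dist z x₀ := fun z => by
    rw [dist_eq_norm, dist_eq_norm, ← R.norm_map (z - x₀), map_sub]
    congr 1
    abel
  have hclosure := closure_ball x₀ hr.ne'
  have hv : SatisfiesSolitonEq lam (Metric.ball x₀ r) fun z => u (R z + (x₀ - R x₀)) :=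
    hsol.comp_isometry Metric.isOpen_ball R _ fun z hz => by
      rw [Metric.mem_ball, hdist]; exact hz
  have hvc : ContinuousOn (fun z => u (R z + (x₀ - R x₀))) (Metric.closedBall x₀ r) :=
    hcont.comp (R.continuous.add continuous_const).continuousOn fun z hz => by
      rw [Metric.mem_closedBall, hdist]; exact hz
  have hle := hsol.le_of_le_frontier Metric.isOpen_ball Metric.isBounded_ball hv
    (hclosure ▸ hcont) (hclosure ▸ hvc) (fun z hz => by
      rw [frontier_ball x₀ hr.ne'] at hz
      rw [hzero z hz, hzero _ (by rw [Metric.mem_sphere, hdist]; exact hz)]) x (hclosure ▸ hx)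
  have hxy' : R x + (x₀ - R x₀) = y := by
    rw [map_sub] at hR
    rw [← sub_add_cancel y x₀, ← hR]
    abel
  rwa [hxy'] at hle
end

section
/- (No interior extrema depending on the sign of 1 + 2λ.) Let D ⊆ ℝ² be an open set, λ ∈ ℝ, and let u satisfy the λ-soliton graph equation on D. If λ > −1/2, then u has no local maximum at any point of D. If λ < −1/2, then u has no local minimum at any point of D. Equivalently: if u attains a local maximum at an interior point then λ ≤ −1/2, and if u attains a local minimum at an interior point then λ ≥ −1/2. -/
open MeasureTheory

open Filter Topology in
theorem IsLocalMax.deriv_deriv_nonpos {g : ℝ → ℝ} {a : ℝ} (h : IsLocalMax g a)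
    (hc : ContinuousAt g a) : deriv (deriv g) a ≤ 0 := by
  by_contra! hpos
  have hmin : IsLocalMin g a := isLocalMin_of_deriv_deriv_pos hpos h.deriv_eq_zero hc
  have hconst : g =ᶠ[𝓝 a] fun _ => g a := by
    filter_upwards [h, hmin] with x hx hx'
    exact le_antisymm hx hx'
  have hzero : deriv (deriv g) a = 0 := by
    rw [hconst.deriv.deriv_eq]
    simp
  exact hpos.ne' hzero

theorem IsLocalMin.deriv_deriv_nonneg {g : ℝ → ℝ} {a : ℝ} (h : IsLocalMin g a)
    (hc : ContinuousAt g a) : 0 ≤ deriv (deriv g) a := by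
  have hneg := h.neg.deriv_deriv_nonpos hc.neg
  have hd : deriv (fun x => -g x) = fun x => -deriv g x := funext fun x => deriv.fun_neg
  rw [hd, deriv.fun_neg] at hneg
  linarith

theorem ContDiffAt.differentiableAt_gradient {F : Type*} [NormedAddCommGroup F]
    [InnerProductSpace ℝ F] [CompleteSpace F] {u : F → ℝ} {p : F} (hu : ContDiffAt ℝ 2 u p) :
    DifferentiableAt ℝ (gradient u) p := by
  have hd : DifferentiableAt ℝ (fderiv ℝ u) p :=
    (hu.fderiv_right (m := 1) (by norm_num)).differentiableAt (by norm_num)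
  exact ((InnerProductSpace.toDual ℝ F).symm.toContinuousLinearEquiv.differentiableAt).comp p hd

/-- The second derivative of `u` along a line is the Hessian quadratic form. -/
theorem ContDiffAt.deriv_deriv_line {F : Type*} [NormedAddCommGroup F]
    [InnerProductSpace ℝ F] [CompleteSpace F] {u : F → ℝ} {p : F} (hu : ContDiffAt ℝ 2 u p)
    (v : F) :
    deriv (deriv fun t : ℝ => u (p + t • v)) 0 =
      Inner.inner ℝ (fderiv ℝ (gradient u) p v) v := by
  have hline : ∀ t : ℝ, HasDerivAt (fun t : ℝ => p + t • v) v t := fun t => by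
    simpa using ((hasDerivAt_id t).smul_const v).const_add p
  have hlim : Filter.Tendsto (fun t : ℝ => p + t • v) (nhds 0) (nhds p) := by
    simpa [ContinuousAt] using (hline 0).continuousAt
  have hderiv : deriv (fun t : ℝ => u (p + t • v)) =ᶠ[nhds 0]
      fun t => Inner.inner ℝ (gradient u (p + t • v)) v := by
    filter_upwards [hlim.eventually (hu.eventually (by simp))] with t ht
    have hd : DifferentiableAt ℝ u (p + t • v) := ht.differentiableAt (by norm_num)
    have := hd.hasGradientAt.hasFDerivAt.comp_hasDerivAt t (hline t)
    simpa [Function.comp_def] using this.deriv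
  rw [hderiv.deriv_eq]
  have hgrad : HasFDerivAt (gradient u) (fderiv ℝ (gradient u) p) (p + (0 : ℝ) • v) := by
    simpa using hu.differentiableAt_gradient.hasFDerivAt
  simpa using ((hgrad.comp_hasDerivAt (0 : ℝ) (hline 0)).inner ℝ
    (hasDerivAt_const (0 : ℝ) v)).deriv

/-- At a critical point, the divergence of `∇u / W(u)` is the Laplacian of `u`. -/
theorem div2_eq_sum_deriv_deriv {u : E2 → ℝ} {p : E2} (hu : ContDiffAt ℝ 2 u p)
    (hp : gradient u p = 0) :
    div2 (fun y => (W u y)⁻¹ • gradient u y) p =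
      ∑ i : Fin 2, deriv (deriv fun t : ℝ => u (p + t • EuclideanSpace.single i (1 : ℝ))) 0 := by
  have hgrad := hu.differentiableAt_gradient
  have hW : DifferentiableAt ℝ (fun y => (W u y)⁻¹) p := by
    have hpos : 0 < 1 + ‖gradient u p‖ ^ 2 := by positivity
    exact (((hgrad.norm_sq ℝ).const_add 1).sqrt hpos.ne').inv (Real.sqrt_pos.2 hpos).ne'
  have hWp : W u p = 1 := by simp [W, hp]
  unfold div2
  refine Finset.sum_congr rfl fun i _ => ?_
  rw [hu.deriv_deriv_line, fderiv_fun_smul hW hgrad]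
  simp [hp, hWp, EuclideanSpace.inner_single_right]

theorem IsLocalExtr.gradient_eq_zero {F : Type*} [NormedAddCommGroup F]
    [InnerProductSpace ℝ F] [CompleteSpace F] {u : F → ℝ} {p : F} (h : IsLocalExtr u p) :
    gradient u p = 0 := by
  simp [gradient, h.fderiv_eq_zero]

/-- No interior extrema depending on the sign of 1 + 2λ: if λ > -1/2 then a λ-translating
graph has no interior local maximum, and if λ < -1/2 it has no interior local minimum. -/
theorem no_interior_extrema
    (D : Set E2) (hDopen : IsOpen D)
    (lam : ℝ) (u : E2 → ℝ)
    (hsol : SatisfiesSolitonEq lam D u) :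
    (lam > -1/2 → ∀ p ∈ D, ¬ IsLocalMax u p) ∧
    (lam < -1/2 → ∀ p ∈ D, ¬ IsLocalMin u p) := by
  obtain ⟨hreg, heq⟩ := hsol
  have hlaplace : ∀ p ∈ D, IsLocalExtr u p →
      ∑ i : Fin 2, deriv (deriv fun t : ℝ => u (p + t • EuclideanSpace.single i (1 : ℝ))) 0 =
        2 * lam + 1 := by
    intro p hp hext
    have hcrit := hext.gradient_eq_zero
    rw [← div2_eq_sum_deriv_deriv (hreg.contDiffAt (hDopen.mem_nhds hp)) hcrit, heq p hp]
    simp [W, hcrit]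
  have hline : ∀ p v : E2, ContinuousAt (fun t : ℝ => p + t • v) 0 := fun p v => by fun_prop
  have hcont : ∀ p ∈ D, ∀ v : E2, ContinuousAt (fun t : ℝ => u (p + t • v)) 0 := by
    intro p hp v
    refine ContinuousAt.comp (g := u) ?_ (hline p v)
    simpa using (hreg.contDiffAt (hDopen.mem_nhds hp)).continuousAt
  refine ⟨fun hlam p hp hmax => ?_, fun hlam p hp hmin => ?_⟩
  · have hsum := hlaplace p hp (Or.inr hmax)
    have hle : ∑ i : Fin 2,
        deriv (deriv fun t : ℝ => u (p + t • EuclideanSpace.single i (1 : ℝ))) 0 ≤ 0 :=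
      Finset.sum_nonpos fun i _ => IsLocalMax.deriv_deriv_nonpos
        (IsLocalMax.comp_continuous (f := u) (by simpa using hmax) (hline p _)) (hcont p hp _)
    linarith
  · have hsum := hlaplace p hp (Or.inl hmin)
    have hge : 0 ≤ ∑ i : Fin 2,
        deriv (deriv fun t : ℝ => u (p + t • EuclideanSpace.single i (1 : ℝ))) 0 :=
      Finset.sum_nonneg fun i _ => IsLocalMin.deriv_deriv_nonneg
        (IsLocalMin.comp_continuous (f := u) (by simpa using hmin) (hline p _)) (hcont p hp _)
    linarith
end
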